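/- Let V be a vector space over ℂ, D : V → V linear, n a positive integer, J, λ ∈ ℂ, and suppose (θ_j^+), (θ_j^−) satisfy the coupled system for all j ≥ 1 (with θ_j^± = 0 for j < 0) and θ_0^− = 0. Then the system decouples: for every j ≥ 2, (2λ+j−1)·j·θ_j^+ = (D² + ((2λ+n+j−3)(j−2)/(2n))·J + ((2λ+j−1)(n+j−2)/(2n))·J)·θ_{j−2}^+ − ((2λ+n+j−3)(n+j−4)/(4n²))·J²·θ_{j−4}^+, and (j−1)·(2λ+j)·θ_j^− = (D² + ((2λ+j−2)(n+j−3)/(2n))·J + ((2λ+n+j−2)(j−1)/(2n))·J)·θ_{j−2}^− − ((2λ+n+j−4)(n+j−3)/(4n²))·J²·θ_{j−4}^−. -/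

import Mathlib

/-- The coupled system: for every `j ≥ 1`,
`j·θ⁺_j = D θ⁻_{j−1} + ((n+j−2)/(2n))·J·θ⁺_{j−2}` and
`(2λ+j)·θ⁻_j = D θ⁺_{j−1} + ((2λ+n+j−2)/(2n))·J·θ⁻_{j−2}`,
with the convention `θ^±_j = 0` for `j < 0`. -/
def CoupledSystem {V : Type*} [AddCommGroup V] [Module ℂ V] (D : V →ₗ[ℂ] V)
    (n : ℕ) (J lam : ℂ) (θp θm : ℕ → V) : Prop :=
  ∀ j : ℕ, 1 ≤ j →
    (j : ℂ) • θp j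
        = D (θm (j - 1))
          + ((((n : ℂ) + (j : ℂ) - 2) / (2 * (n : ℂ))) * J) • (if 2 ≤ j then θp (j - 2) else 0)
    ∧ (2 * lam + (j : ℂ)) • θm j
        = D (θp (j - 1))
          + (((2 * lam + (n : ℂ) + (j : ℂ) - 2) / (2 * (n : ℂ))) * J)
              • (if 2 ≤ j then θm (j - 2) else 0)

/-- Eliminating `y` and `z` from three consecutive first-order relations. -/
lemma LinearMap.eliminate_of_chain {V : Type*} [AddCommGroup V] [Module ℂ V] (D : V →ₗ[ℂ] V)
    {a b c d e f : ℂ} {x y z p q : V} (hx : a • x = D y + b • p) (hy : c • y = D p + d • z)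
    (hp : e • p = D z + f • q) :
    (c * a) • x = D (D p) + (d * e + c * b) • p - (d * f) • q := by
  have hDz : D z = e • p - f • q := by rw [hp]; abel
  rw [mul_smul, hx, smul_add, ← map_smul, hy, map_add, map_smul, hDz]
  module

/-- The system at index `j`, extended to `j = 0`, where it holds as soon as `θ⁻₀ = 0`. -/
lemma CoupledSystem.shifted {V : Type*} [AddCommGroup V] [Module ℂ V] {D : V →ₗ[ℂ] V}
    {n : ℕ} {J lam : ℂ} {θp θm : ℕ → V} (h : CoupledSystem D n J lam θp θm) (h0 : θm 0 = 0)
    (k : ℕ) :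
    (k : ℂ) • θp k
        = D (if 1 ≤ k then θm (k - 1) else 0)
          + ((((n : ℂ) + (k : ℂ) - 2) / (2 * (n : ℂ))) * J) • (if 2 ≤ k then θp (k - 2) else 0)
    ∧ (2 * lam + (k : ℂ)) • θm k
        = D (if 1 ≤ k then θp (k - 1) else 0)
          + (((2 * lam + (n : ℂ) + (k : ℂ) - 2) / (2 * (n : ℂ))) * J)
              • (if 2 ≤ k then θm (k - 2) else 0) := by
  rcases Nat.eq_zero_or_pos k with rfl | hk
  · simp [h0]
  · simpa only [if_pos (Nat.succ_le_of_lt hk)] using h k hk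

/-- The coupled system decouples into fourth-order (in the index) recurrences for `θ⁺`
and `θ⁻` separately. -/
theorem stmt10 {V : Type*} [AddCommGroup V] [Module ℂ V] (D : V →ₗ[ℂ] V)
    (n : ℕ) (hn : 0 < n) (J lam : ℂ) (θp θm : ℕ → V)
    (h : CoupledSystem D n J lam θp θm) (h0 : θm 0 = 0) :
    ∀ j : ℕ, 2 ≤ j →
      ((2 * lam + (j : ℂ) - 1) * (j : ℂ)) • θp j
          = D (D (θp (j - 2)))
            + ((2 * lam + (n : ℂ) + (j : ℂ) - 3) * ((j : ℂ) - 2) / (2 * (n : ℂ)) * J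
                + (2 * lam + (j : ℂ) - 1) * ((n : ℂ) + (j : ℂ) - 2) / (2 * (n : ℂ)) * J)
                • θp (j - 2)
            - ((2 * lam + (n : ℂ) + (j : ℂ) - 3) * ((n : ℂ) + (j : ℂ) - 4) / (4 * (n : ℂ) ^ 2)
                * J ^ 2) • (if 4 ≤ j then θp (j - 4) else 0)
      ∧ (((j : ℂ) - 1) * (2 * lam + (j : ℂ))) • θm j
          = D (D (θm (j - 2)))
            + ((2 * lam + (j : ℂ) - 2) * ((n : ℂ) + (j : ℂ) - 3) / (2 * (n : ℂ)) * J
                + (2 * lam + (n : ℂ) + (j : ℂ) - 2) * ((j : ℂ) - 1) / (2 * (n : ℂ)) * J)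
                • θm (j - 2)
            - ((2 * lam + (n : ℂ) + (j : ℂ) - 4) * ((n : ℂ) + (j : ℂ) - 3) / (4 * (n : ℂ) ^ 2)
                * J ^ 2) • (if 4 ≤ j then θm (j - 4) else 0) := by
  intro j hj
  obtain ⟨k, rfl⟩ := Nat.exists_eq_add_of_le' hj
  obtain ⟨hp2, hm2⟩ := h (k + 2) (by omega)
  obtain ⟨hp1, hm1⟩ := h (k + 1) (by omega)
  obtain ⟨hp0, hm0⟩ := h.shifted h0 k
  simp only [if_pos hj, Nat.add_sub_cancel, show k + 2 - 1 = k + 1 by omega,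
    show k + 1 - 2 = k - 1 by omega, show 2 ≤ k + 1 ↔ 1 ≤ k by omega] at hp2 hm2 hp1 hm1
  simp only [Nat.add_sub_cancel, show k + 2 - 4 = k - 2 by omega,
    show 4 ≤ k + 2 ↔ 2 ≤ k by omega]
  constructor
  · convert D.eliminate_of_chain hp2 hm1 hp0 using 2
    · push_cast; ring
    · congr 2
      push_cast; ring
    · congr 1
      push_cast; ring
  · convert D.eliminate_of_chain hm2 hp1 hm0 using 2
    · push_cast; ring
    · congr 2
      push_cast; ring
    · congr 1
      push_cast; ring
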